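/- arXiv:2206.09402 — 3 statements merged into one kernel-verified Lean document; each statement's English description precedes it below -/
import Mathlib

section
/- Suppose Condition (C) holds. Then lim_{n→∞} η_{n,n}(2) = −σ, where for n ≥ 1, η_{n,n}(2) denotes the probability that the chain Y started at Y₀ = n enters the set [n+1,∞) for the first time at the site n+2 (i.e., with τ = inf{j ≥ 0 : Y_j ≥ n+1}, η_{n,n}(2) = P(τ < ∞ and Y_τ = n+2 | Y₀ = n)). -/
open Filter MeasureTheory ENNReal Topology

noncomputable section

/-- Transition function of the (1,2) random walk `Y`. -/
def transY (q p1 p2 : ℕ → ℝ) (n j : ℕ) : ℝ :=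
  if n = 0 then (if j = 2 then 1 else 0)
  else if n = 1 then (if j = 0 then 1 else 0)
  else if j = n - 1 then q n
  else if j = n + 1 then p1 n
  else if j = n + 2 then p2 n
  else 0

/-- `μ` is the law (on path space) of the time-homogeneous Markov chain on `ℕ`
with one-step transition probabilities `p` and initial state `init`. -/
def IsMarkovChain (μ : Measure (ℕ → ℕ)) (p : ℕ → ℕ → ℝ) (init : ℕ) : Prop :=
  μ {ω | ω 0 = init} = 1 ∧
  ∀ (k : ℕ) (x : ℕ → ℕ) (j : ℕ),
    μ {ω | (∀ i ≤ k, ω i = x i) ∧ ω (k + 1) = j}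
      = ENNReal.ofReal (p (x k) j) * μ {ω | ∀ i ≤ k, ω i = x i}

/-- First-exit probabilities, by first-step recursion. -/
def hitRec (p : ℕ → ℕ → ℝ) (n j : ℕ) : ℕ → ℕ → ℝ≥0∞
  | 0, y => if y = j then 1 else 0
  | t + 1, y => if y ≤ n then ∑' z, ENNReal.ofReal (p y z) * hitRec p n j t z else 0

theorem word_markov (μ : Measure (ℕ → ℕ)) (p : ℕ → ℕ → ℝ) (init : ℕ)
    (h : IsMarkovChain μ p init) (n j : ℕ) (t : ℕ) : ∀ (k : ℕ) (x : ℕ → ℕ),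
    μ {ω | (∀ i ≤ k, ω i = x i) ∧ ω (k + t) = j ∧ ∀ i < t, ω (k + i) ≤ n}
      = hitRec p n j t (x k) * μ {ω | ∀ i ≤ k, ω i = x i} := by
  induction t with
  | zero =>
    intro k x
    by_cases hx : x k = j
    · simp only [hitRec, hx, if_true, one_mul]
      congr 1
      ext ω
      constructor
      · exact fun h1 => h1.1
      · intro h1
        exact ⟨h1, (h1 k le_rfl).trans hx, fun i hi => absurd hi (by omega)⟩
    · simp only [hitRec, hx, if_false, zero_mul]
      convert measure_empty (μ := μ)
      ext ω
      simp only [Set.mem_ofPred_eq, Set.mem_empty_iff_false, iff_false]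
      rintro ⟨h1, h2, -⟩
      exact hx (by rw [← h1 k le_rfl]; simpa using h2)
  | succ t ih =>
    intro k x
    by_cases hx : x k ≤ n
    · simp only [hitRec, hx, if_true]
      have hU : {ω : ℕ → ℕ | (∀ i ≤ k, ω i = x i) ∧ ω (k + (t + 1)) = j ∧
            ∀ i < t + 1, ω (k + i) ≤ n}
          = ⋃ z, {ω : ℕ → ℕ | (∀ i ≤ k + 1, ω i = (Function.update x (k + 1) z) i) ∧
            ω (k + 1 + t) = j ∧ ∀ i < t, ω (k + 1 + i) ≤ n} := by
        ext ω
        simp only [Set.mem_ofPred_eq, Set.mem_iUnion]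
        constructor
        · rintro ⟨h1, h2, h3⟩
          refine ⟨ω (k + 1), ?_, ?_, ?_⟩
          · intro i hi
            rcases Nat.lt_or_ge k i with hk | hk
            · have : i = k + 1 := by omega
              subst this; simp
            · rw [Function.update_of_ne (by omega)]; exact h1 i hk
          · rw [← h2]; congr 1; omega
          · intro i hi
            have := h3 (i + 1) (by omega)
            rwa [show k + 1 + i = k + (i + 1) by omega]
        · rintro ⟨z, h1, h2, h3⟩
          have h1' : ∀ i ≤ k, ω i = x i := by
            intro i hi
            rw [h1 i (by omega), Function.update_of_ne (by omega)]
          refine ⟨h1', ?_, ?_⟩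
          · rw [← h2]; congr 1; omega
          · intro i hi
            rcases i with _ | i
            · rw [add_zero, h1' k le_rfl]; exact hx
            · have := h3 i (by omega)
              rwa [show k + (i + 1) = k + 1 + i by omega]
      rw [hU, measure_iUnion, ← ENNReal.tsum_mul_right]
      · congr 1
        ext z
        rw [ih (k + 1) (Function.update x (k + 1) z)]
        have hw : {ω : ℕ → ℕ | ∀ i ≤ k + 1, ω i = (Function.update x (k + 1) z) i}
            = {ω | (∀ i ≤ k, ω i = x i) ∧ ω (k + 1) = z} := by
          ext ω
          simp only [Set.mem_ofPred_eq]
          constructor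
          · intro h1
            refine ⟨fun i hi => ?_, ?_⟩
            · rw [h1 i (by omega), Function.update_of_ne (by omega)]
            · rw [h1 _ le_rfl, Function.update_self]
          · rintro ⟨h1, h2⟩ i hi
            rcases Nat.lt_or_ge k i with hk | hk
            · have : i = k + 1 := by omega
              subst this; simpa using h2
            · rw [Function.update_of_ne (by omega)]; exact h1 i hk
        rw [hw, h.2 k x z, Function.update_self]
        ring
      · intro z z' hz
        rw [Function.onFun, Set.disjoint_left]
        rintro ω ⟨h1, -⟩ ⟨h2, -⟩
        apply hz
        have e1 := h1 (k + 1) le_rfl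
        have e2 := h2 (k + 1) le_rfl
        rw [Function.update_self] at e1 e2
        rw [← e1, ← e2]
      · intro z
        measurability
    · simp only [hitRec, hx, if_false, zero_mul]
      convert measure_empty (μ := μ)
      ext ω
      simp only [Set.mem_ofPred_eq, Set.mem_empty_iff_false, iff_false]
      rintro ⟨h1, -, h3⟩
      apply hx
      rw [← h1 k le_rfl]
      exact h3 0 (by omega)

theorem exit_eq_tsum (μ : Measure (ℕ → ℕ)) [IsProbabilityMeasure μ] (p : ℕ → ℕ → ℝ) (y : ℕ)
    (h : IsMarkovChain μ p y) (n j : ℕ) (hj : n < j) :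
    μ {ω | ∃ t, ω t = j ∧ ∀ i < t, ω i ≤ n} = ∑' t, hitRec p n j t y := by
  have hU : {ω : ℕ → ℕ | ∃ t, ω t = j ∧ ∀ i < t, ω i ≤ n}
      = ⋃ t, {ω | ω t = j ∧ ∀ i < t, ω i ≤ n} := by
    ext ω; simp
  rw [hU, measure_iUnion]
  · congr 1
    ext t
    have h0 := word_markov μ p y h n j t 0 (fun _ => y)
    have hw : {ω : ℕ → ℕ | ∀ i ≤ 0, ω i = y} = {ω | ω 0 = y} := by
      ext ω; simp
    rw [hw, h.1, mul_one] at h0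
    rw [← h0]
    have hae : ∀ᵐ ω ∂μ, ω 0 = y := by
      have h1 := h.1
      rw [← prob_compl_eq_zero_iff (by measurability)] at h1
      exact h1
    apply measure_congr
    filter_upwards [hae] with ω hω
    apply propext
    change (ω t = j ∧ ∀ i < t, ω i ≤ n) ↔
      ((∀ i ≤ 0, ω i = y) ∧ ω (0 + t) = j ∧ ∀ i < t, ω (0 + i) ≤ n)
    simp [hω]
  · intro s t hst
    rw [Function.onFun, Set.disjoint_left]
    rintro ω ⟨h1, h2⟩ ⟨h3, h4⟩
    rcases lt_or_gt_of_ne hst with hl | hl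
    · have := h4 s hl; omega
    · have := h2 t hl; omega
  · intro t
    measurability

theorem tsum_step (p : ℕ → ℕ → ℝ) (n j : ℕ) (hj : n < j) (y : ℕ) :
    ∑' t, hitRec p n j t y = (if y = j then 1 else 0) +
      if y ≤ n then ∑' z, ENNReal.ofReal (p y z) * ∑' t, hitRec p n j t z else 0 := by
  rw [tsum_eq_zero_add' ENNReal.summable]
  simp only [hitRec]
  congr 1
  split_ifs
  · rw [ENNReal.tsum_comm]
    simp_rw [ENNReal.tsum_mul_left]
  · simp

/-- The continued-fraction recursion. -/
def ratioSeq (A B : ℕ → ℝ) : ℕ → ℝ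
  | 0 => 0
  | k + 1 => if k = 0 then 0 else B (k + 1) / (A (k + 1) + ratioSeq A B k)

theorem ratio_diff (q p1 p2 G : ℕ → ℝ) (n : ℕ)
    (hq : ∀ k, 2 ≤ k → 0 < q k) (hp1 : ∀ k, 2 ≤ k → 0 ≤ p1 k)
    (hp2 : ∀ k, 2 ≤ k → 0 < p2 k)
    (hsum : ∀ k, 2 ≤ k → q k + p1 k + p2 k = 1)
    (h0 : G 0 = G 2) (h1 : G 1 = G 0)
    (hG : ∀ k, 2 ≤ k → k ≤ n → G k = q k * G (k - 1) + p1 k * G (k + 1) + p2 k * G (k + 2)) :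
    ∀ k, k + 1 ≤ n →
      0 ≤ ratioSeq (fun k => (p1 k + p2 k) / q k) (fun k => p2 k / q k) (k + 1) ∧
      ratioSeq (fun k => (p1 k + p2 k) / q k) (fun k => p2 k / q k) (k + 1) ≤ 1 ∧
      G (k + 2) - G (k + 1) =
      - ratioSeq (fun k => (p1 k + p2 k) / q k) (fun k => p2 k / q k) (k + 1)
        * (G (k + 3) - G (k + 2)) := by
  intro k
  induction k with
  | zero => intro _; simp [ratioSeq, h1, h0]
  | succ k ih =>
    intro hk
    obtain ⟨i1, i2, i3⟩ := ih (by omega)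
    rw [ratioSeq, if_neg (by omega)]
    set r := ratioSeq (fun k => (p1 k + p2 k) / q k) (fun k => p2 k / q k) (k + 1)
    have hQ := hq (k + 2) (by omega)
    have hP1 := hp1 (k + 2) (by omega)
    have hP2 := hp2 (k + 2) (by omega)
    have hS := hsum (k + 2) (by omega)
    have hGk := hG (k + 2) (by omega) (by omega)
    simp only [show k + 1 + 1 = k + 2 by omega, show k + 1 + 2 = k + 3 by omega,
      show k + 1 + 3 = k + 4 by omega, show k + 2 - 1 = k + 1 by omega,
      show k + 2 + 1 = k + 3 by omega, show k + 2 + 2 = k + 4 by omega] at *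
    have hD : 0 < p1 (k + 2) + p2 (k + 2) + q (k + 2) * r := by positivity
    have e : p2 (k + 2) / q (k + 2) / ((p1 (k + 2) + p2 (k + 2)) / q (k + 2) + r)
        = p2 (k + 2) / (p1 (k + 2) + p2 (k + 2) + q (k + 2) * r) := by
      field_simp
    rw [e]
    refine ⟨by positivity, ?_, ?_⟩
    · rw [div_le_one hD]
      have : 0 ≤ q (k + 2) * r := by positivity
      linarith
    · rw [neg_mul, div_mul_eq_mul_div, eq_neg_iff_add_eq_zero, ← sub_neg_eq_add, sub_eq_zero,
        ← neg_div, eq_div_iff hD.ne']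
      linear_combination q (k + 2) * i3 - hGk - G (k + 2) * hS

theorem tendsto_zero_two_step (e ε : ℕ → ℝ) (ρ M : ℝ) (hρ0 : 0 ≤ ρ) (hρ : ρ < 1)
    (h0 : ∀ n, 0 ≤ e n) (hM : ∀ n, e n ≤ M) (hε : Tendsto ε atTop (𝓝 0))
    (h : ∀ᶠ n in atTop, e (n + 2) ≤ ρ * e n + ε n) : Tendsto e atTop (𝓝 0) := by
  have key : ∀ δ > 0, ∀ k : ℕ, ∀ᶠ n in atTop, e n ≤ ρ ^ k * M + δ := by
    intro δ hδ k
    induction k with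
    | zero =>
      refine Eventually.of_forall fun n => ?_
      have := hM n
      simp; linarith
    | succ k ih =>
      have h2 : ∀ᶠ n in atTop, ε n < δ * (1 - ρ) :=
        hε.eventually_lt_const (by nlinarith)
      have h3 : ∀ᶠ n in atTop, e (n + 2) ≤ ρ ^ (k + 1) * M + δ := by
        filter_upwards [h, h2, ih] with n a1 a2 a3
        have := mul_le_mul_of_nonneg_left a3 hρ0
        rw [pow_succ]
        nlinarith
      rw [eventually_atTop] at h3 ⊢
      obtain ⟨N, hN⟩ := h3
      refine ⟨N + 2, fun n hn => ?_⟩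
      have := hN (n - 2) (by omega)
      rwa [show n - 2 + 2 = n by omega] at this
  rw [Metric.tendsto_atTop']
  intro δ hδ
  have hp : Tendsto (fun k : ℕ => ρ ^ k * M) atTop (𝓝 0) := by
    simpa using (tendsto_pow_atTop_nhds_zero_of_lt_one hρ0 hρ).mul_const M
  obtain ⟨k, hk⟩ := (hp.eventually_lt_const (half_pos hδ)).exists
  obtain ⟨N, hN⟩ := eventually_atTop.1 (key (δ / 2) (half_pos hδ) k)
  refine ⟨N, fun n hn => ?_⟩
  rw [Real.dist_eq, sub_zero, abs_of_nonneg (h0 n)]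
  have := hN n hn.le
  linarith

theorem ratio_tendsto (A B r : ℕ → ℝ) (a b u : ℝ) (ha : 0 < a) (hb : 0 < b) (hu : 0 < u)
    (hub : u ^ 2 + a * u = b) (hA : Tendsto A atTop (𝓝 a)) (hB : Tendsto B atTop (𝓝 b))
    (hr0 : ∀ n, 0 ≤ r n) (hr1 : ∀ n, r n ≤ 1)
    (hA0 : ∀ n, 2 ≤ n → 0 < A n) (hB0 : ∀ n, 2 ≤ n → 0 < B n)
    (hr : ∀ n, 1 ≤ n → r (n + 1) = B (n + 1) / (A (n + 1) + r n)) :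
    Tendsto r atTop (𝓝 u) := by
  rw [tendsto_iff_dist_tendsto_zero]
  simp only [Real.dist_eq]
  have hD0 : 0 < a ^ 2 + b := by positivity
  have hA1 := (tendsto_add_atTop_iff_nat 1).2 hA
  have hA2 := (tendsto_add_atTop_iff_nat 2).2 hA
  have hB1 := (tendsto_add_atTop_iff_nat 1).2 hB
  have hB2 := (tendsto_add_atTop_iff_nat 2).2 hB
  let ε : ℕ → ℝ := fun n => (|B (n + 2) * A (n + 1) - b * a| + |B (n + 2) - b|
    + (|A (n + 2) * A (n + 1) - a * a| + |A (n + 2) - a| + |B (n + 1) - b|)) / (a ^ 2 + b)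
  have hz : ∀ {f : ℕ → ℝ} {c : ℝ}, Tendsto f atTop (𝓝 c) →
      Tendsto (fun n => |f n - c|) atTop (𝓝 0) := by
    intro f c hf
    simpa using (hf.sub_const c).abs
  refine tendsto_zero_two_step _ ε (u ^ 2 / (a ^ 2 + b)) (1 + u) (by positivity) ?_
    (fun n => abs_nonneg _) ?_ ?_ ?_
  · rw [div_lt_one hD0]; nlinarith [mul_pos ha hu, mul_pos ha ha]
  · intro n
    rw [abs_le]
    constructor <;> linarith [hr0 n, hr1 n]
  · have := ((((hz (hB2.mul hA1)).add (hz hB2)).add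
      (((hz (hA2.mul hA1)).add (hz hA2)).add (hz hB1)))).div_const (a ^ 2 + b)
    simpa using this
  · filter_upwards [eventually_ge_atTop 1] with n hn
    have e1 := hr n hn
    have e2 := hr (n + 1) (by omega)
    rw [show n + 1 + 1 = n + 2 by omega] at e2
    have x0 := hr0 n
    have x1 := hr1 n
    have y0 := hr0 (n + 2)
    have y1 := hr1 (n + 2)
    have z0 := hr0 (n + 1)
    have a1 := hA0 (n + 1) (by omega)
    have a2 := hA0 (n + 2) (by omega)
    rw [_root_.eq_div_iff (by positivity)] at e1 e2
    simp only [ε]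
    generalize r (n + 2) = y at *
    generalize r (n + 1) = w at *
    generalize r n = x at *
    generalize A (n + 1) = A1 at *
    generalize A (n + 2) = A2 at *
    generalize B (n + 1) = B1 at *
    generalize B (n + 2) = B2 at *
    have e3 : y * (A2 * (A1 + x) + B1) = B2 * (A1 + x) := by
      linear_combination (A1 + x) * e2 - y * e1
    have hmain : (y - u) * (a * (a + x) + b) = u ^ 2 * (x - u) + ((B2 * A1 - b * a)
        + (B2 - b) * x - y * ((A2 * A1 - a * a) + (A2 - a) * x + (B1 - b))) := by
      subst hub
      linear_combination e3
    have hx : ∀ c : ℝ, |c * x| ≤ |c| := fun c => by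
      rw [abs_mul, abs_of_nonneg x0]; exact mul_le_of_le_one_right (abs_nonneg _) x1
    have hy : ∀ c : ℝ, |y * c| ≤ |c| := fun c => by
      rw [abs_mul, abs_of_nonneg y0]; exact mul_le_of_le_one_left (abs_nonneg _) y1
    have hle : |y - u| * (a ^ 2 + b) ≤ |(y - u) * (a * (a + x) + b)| := by
      rw [abs_mul]
      refine mul_le_mul_of_nonneg_left ?_ (abs_nonneg _)
      refine le_trans ?_ (le_abs_self _)
      nlinarith [mul_nonneg ha.le x0]
    rw [div_mul_eq_mul_div, ← add_div, le_div_iff₀ hD0]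
    refine hle.trans ?_
    rw [hmain]
    refine (abs_add_le _ _).trans ?_
    rw [abs_mul, abs_of_nonneg (sq_nonneg u)]
    gcongr
    refine (abs_sub _ _).trans ?_
    refine add_le_add ((abs_add_le _ _).trans (add_le_add le_rfl (hx _))) ((hy _).trans ?_)
    refine (abs_add_le _ _).trans (add_le_add ((abs_add_le _ _).trans ?_) le_rfl)
    exact add_le_add le_rfl (hx _)

theorem tsum_transY (q p1 p2 : ℕ → ℝ) (k : ℕ) (hk : 2 ≤ k) (g : ℕ → ℝ≥0∞) :
    ∑' z, ENNReal.ofReal (transY q p1 p2 k z) * g z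
      = ENNReal.ofReal (q k) * g (k - 1) + ENNReal.ofReal (p1 k) * g (k + 1)
        + ENNReal.ofReal (p2 k) * g (k + 2) := by
  have hk0 : k ≠ 0 := by omega
  have hk1 : k ≠ 1 := by omega
  rw [tsum_eq_sum (s := {k - 1, k + 1, k + 2})]
  · rw [Finset.sum_insert, Finset.sum_insert, Finset.sum_singleton, ← add_assoc]
    · simp only [transY, hk0, hk1, if_false, if_true]
      rw [if_neg (by omega : k + 1 ≠ k - 1), if_neg (by omega : k + 2 ≠ k - 1),
        if_neg (by omega : k + 2 ≠ k + 1)]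
    · simp
    · simp only [Finset.mem_insert, Finset.mem_singleton]; omega
  · intro z hz
    simp only [Finset.mem_insert, Finset.mem_singleton, not_or] at hz
    simp [transY, hk0, hk1, hz.1, hz.2.1, hz.2.2]

theorem eta_limit
    (q p1 p2 : ℕ → ℝ)
    (hq : ∀ k, 2 ≤ k → 0 < q k) (hp1 : ∀ k, 2 ≤ k → 0 ≤ p1 k)
    (hp2 : ∀ k, 2 ≤ k → 0 < p2 k)
    (hsum : ∀ k, 2 ≤ k → q k + p1 k + p2 k = 1)
    (μ : ℕ → Measure (ℕ → ℕ)) (hprob : ∀ x, IsProbabilityMeasure (μ x))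
    (hμ : ∀ x, IsMarkovChain (μ x) (transY q p1 p2) x)
    (a b : ℝ) (ha : 0 < a) (hb : 0 < b)
    (hCa : Tendsto (fun k => (p1 k + p2 k) / q k) atTop (𝓝 a))
    (hCb : Tendsto (fun k => p2 k / q k) atTop (𝓝 b))
    (σ : ℝ) (hσ : σ = (a - Real.sqrt (a ^ 2 + 4 * b)) / 2) :
    Tendsto
      (fun n : ℕ =>
        ((μ n) {ω | ∃ t, ω t = n + 2 ∧ ∀ i < t, ω i ≤ n}).toReal)
      atTop (𝓝 (-σ)) := by
  have hEta : ∀ n : ℕ, (0 ≤ ratioSeq (fun k => (p1 k + p2 k) / q k) (fun k => p2 k / q k) (n + 1)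
      ∧ ratioSeq (fun k => (p1 k + p2 k) / q k) (fun k => p2 k / q k) (n + 1) ≤ 1) ∧
      ((μ (n + 1)) {ω | ∃ t, ω t = (n + 1) + 2 ∧ ∀ i < t, ω i ≤ n + 1}).toReal
      = ratioSeq (fun k => (p1 k + p2 k) / q k) (fun k => p2 k / q k) (n + 1) := by
    intro n
    set H : ℕ → ℝ≥0∞ := fun y => ∑' t, hitRec (transY q p1 p2) (n + 1) (n + 1 + 2) t y with hH
    have hHμ : ∀ y, μ y {ω | ∃ t, ω t = (n + 1) + 2 ∧ ∀ i < t, ω i ≤ n + 1} = H y := by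
      intro y
      haveI := hprob y
      exact exit_eq_tsum (μ y) _ y (hμ y) (n + 1) (n + 1 + 2) (by omega)
    have hfin : ∀ y, H y ≠ ∞ := by
      intro y
      haveI := hprob y
      rw [← hHμ y]
      exact measure_ne_top _ _
    have hstep : ∀ y, H y = (if y = n + 1 + 2 then 1 else 0) +
        if y ≤ n + 1 then ∑' z, ENNReal.ofReal (transY q p1 p2 y z) * H z else 0 :=
      fun y => tsum_step _ _ _ (by omega) y
    have b1 : H (n + 2) = 0 := by rw [hstep]; simp
    have b2 : H (n + 3) = 1 := by rw [hstep]; simp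
    have c0 : H 0 = H 2 := by
      rw [hstep, if_neg (by omega), if_pos (by omega), zero_add, tsum_eq_single 2]
      · simp [transY]
      · intro z hz; simp [transY, hz]
    have c1 : H 1 = H 0 := by
      rw [hstep, if_neg (by omega), if_pos (by omega), zero_add, tsum_eq_single 0]
      · simp [transY]
      · intro z hz; simp [transY, hz]
    have ck : ∀ k, 2 ≤ k → k ≤ n + 1 → (H k).toReal = q k * (H (k - 1)).toReal
        + p1 k * (H (k + 1)).toReal + p2 k * (H (k + 2)).toReal := by
      intro k hk hkn
      rw [hstep k, if_neg (by omega), if_pos hkn, zero_add, tsum_transY _ _ _ k hk]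
      have f : ∀ (c : ℝ) z, ENNReal.ofReal c * H z ≠ ∞ :=
        fun c z => ENNReal.mul_ne_top ENNReal.ofReal_ne_top (hfin z)
      rw [ENNReal.toReal_add (ENNReal.add_ne_top.2 ⟨f _ _, f _ _⟩) (f _ _),
        ENNReal.toReal_add (f _ _) (f _ _)]
      simp only [ENNReal.toReal_mul]
      rw [ENNReal.toReal_ofReal (hq k hk).le, ENNReal.toReal_ofReal (hp1 k hk),
        ENNReal.toReal_ofReal (hp2 k hk).le]
    obtain ⟨g1, g2, g3⟩ := ratio_diff q p1 p2 (fun y => (H y).toReal) (n + 1) hq hp1 hp2 hsum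
      (by simp only [c0]) (by simp only [c1]) ck n le_rfl
    refine ⟨⟨g1, g2⟩, ?_⟩
    rw [hHμ]
    simp only [b1, b2, ENNReal.toReal_zero, ENNReal.toReal_one] at g3
    linarith
  have hs := Real.sq_sqrt (show (0 : ℝ) ≤ a ^ 2 + 4 * b by positivity)
  have hs0 := Real.sqrt_nonneg (a ^ 2 + 4 * b)
  have hlim : Tendsto (ratioSeq (fun k => (p1 k + p2 k) / q k) (fun k => p2 k / q k)) atTop
      (𝓝 (-σ)) := by
    refine ratio_tendsto _ _ _ a b (-σ) ha hb ?_ ?_ hCa hCb ?_ ?_ ?_ ?_ ?_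
    · rw [hσ]; nlinarith
    · rw [hσ]; nlinarith
    · rintro (_ | n)
      · simp [ratioSeq]
      · exact (hEta n).1.1
    · rintro (_ | n)
      · simp [ratioSeq]
      · exact (hEta n).1.2
    · intro n hn
      have := hq n hn
      have := hp1 n hn
      have := hp2 n hn
      positivity
    · intro n hn
      exact div_pos (hp2 n hn) (hq n hn)
    · intro n hn
      rw [ratioSeq, if_neg (by omega)]
  rw [← tendsto_add_atTop_iff_nat 1]
  rw [← tendsto_add_atTop_iff_nat 1] at hlim
  exact hlim.congr fun n => (hEta n).2.symm

end
end

section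
/- Suppose Condition (C) holds. Then lim_{n→∞} h_n(2) = −σ/(1−σ), where for k ≥ 1, T_k = inf{n ≥ 0 : Y_n ∈ {2k, 2k+1}} is the first entrance time of Y (started at Y₀ = 2) into the layer L_k = {2k, 2k+1}, and h_k(2) = P(T_k < ∞ and Y_{T_k} = 2k+1). -/
open Filter MeasureTheory ENNReal Topology

noncomputable section

lemma contract_lemma (x δ : ℕ → ℝ) (c K : ℝ) (p N₀ : ℕ) (hc0 : 0 ≤ c) (hc : c < 1)
    (hx0 : ∀ n, 0 ≤ x n) (hxK : ∀ n, x n ≤ K)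
    (hδ : Tendsto δ atTop (𝓝 0))
    (h : ∀ n ≥ N₀, x (n + p) ≤ c * x n + δ n) : Tendsto x atTop (𝓝 0) := by
  have hK : 0 ≤ K := (hx0 0).trans (hxK 0)
  rw [Metric.tendsto_atTop]
  intro e he
  have h1 : ∀ᶠ n in atTop, δ n < (e / 2) * (1 - c) :=
    hδ.eventually_lt_const (mul_pos (half_pos he) (by linarith))
  obtain ⟨N₁, hN₁⟩ := eventually_atTop.1 h1
  have key : ∀ j n, max N₀ N₁ + p * j ≤ n → x n ≤ e / 2 + c ^ j * K := by
    intro j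
    induction j with
    | zero => intro n _; have := hxK n; simp; linarith
    | succ j ih =>
      intro n hn
      obtain ⟨m, rfl⟩ : ∃ m, n = m + p := ⟨n - p, by rw [mul_add] at hn; omega⟩
      have hm : max N₀ N₁ + p * j ≤ m := by rw [mul_add] at hn; omega
      have a1 := h m (by omega)
      have a2 := hN₁ m (by omega)
      have a3 := mul_le_mul_of_nonneg_left (ih m hm) hc0
      rw [pow_succ]
      nlinarith
  have h2 : Tendsto (fun j : ℕ => c ^ j * K) atTop (𝓝 0) := by
    simpa using (tendsto_pow_atTop_nhds_zero_of_lt_one hc0 hc).mul_const K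
  obtain ⟨j, hj⟩ := (h2.eventually_lt_const (half_pos he)).exists
  refine ⟨max N₀ N₁ + p * j, fun n hn => ?_⟩
  rw [Real.dist_eq, sub_zero, abs_of_nonneg (hx0 n)]
  linarith [key j n hn]

/-- limit of the continued fraction -/
lemma cf_limit (A B : ℕ → ℝ) (a b s : ℝ) (hA : ∀ n, 0 < A n) (hB : ∀ n, 0 < B n)
    (hBA : ∀ n, B n ≤ A n) (hb : 0 < b) (ha : 0 < a)
    (hAa : Tendsto A atTop (𝓝 a)) (hBb : Tendsto B atTop (𝓝 b))
    (hs : 0 < s) (hs2 : s * s + a * s = b)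
    (S : ℕ → ℝ) (S0 : S 0 = 0) (hS : ∀ n, S (n + 1) = B n / (A n + S n)) :
    (∀ n, 0 ≤ S n ∧ S n ≤ 1) ∧ Tendsto S atTop (𝓝 s) := by
  have h01 : ∀ n, 0 ≤ S n ∧ S n ≤ 1 := by
    intro n
    induction n with
    | zero => simp [S0]
    | succ n ih =>
      rw [hS]
      have := hA n; have := hB n; have := hBA n
      refine ⟨div_nonneg (by linarith) (by linarith), ?_⟩
      rw [div_le_one (by linarith)]; linarith
  refine ⟨h01, ?_⟩
  set ε : ℕ → ℝ := fun n => B n - s * A n - s * s with hε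
  have hεt : Tendsto ε atTop (𝓝 0) := by
    have := (hBb.sub (hAa.const_mul s)).sub_const (s * s)
    have e : b - s * a - s * s = 0 := by rw [← hs2]; ring
    rwa [e] at this
  have hstep : ∀ n, (A n + S n) * |S (n + 1) - s| ≤ |ε n| + s * |S n - s| := by
    intro n
    have hp : 0 < A n + S n := by linarith [hA n, (h01 n).1]
    have : (A n + S n) * (S (n + 1) - s) = ε n - s * (S n - s) := by
      rw [hS, hε]; field_simp; ring
    calc (A n + S n) * |S (n + 1) - s| = |(A n + S n) * (S (n + 1) - s)| := by
          rw [abs_mul, abs_of_pos hp]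
      _ = |ε n - s * (S n - s)| := by rw [this]
      _ ≤ |ε n| + |s * (S n - s)| := abs_sub _ _
      _ = _ := by rw [abs_mul, abs_of_pos hs]
  have hprod : ∀ n, B n ≤ (A (n + 1) + S (n + 1)) * (A n + S n) := by
    intro n
    have hp : 0 < A n + S n := by linarith [hA n, (h01 n).1]
    have : S (n + 1) * (A n + S n) = B n := by rw [hS]; field_simp
    nlinarith [mul_pos (hA (n + 1)) hp]
  set c := (s * s / b + 1) / 2 with hcdef
  have hsb : s * s / b < 1 := by
    rw [div_lt_one hb]; nlinarith
  have hsb0 : 0 ≤ s * s / b := by positivity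
  have hc1 : c < 1 := by rw [hcdef]; linarith
  have hev : ∀ᶠ n in atTop, s * s / B n < c := by
    have : Tendsto (fun n => s * s / B n) atTop (𝓝 (s * s / b)) :=
      tendsto_const_nhds.div hBb hb.ne'
    exact this.eventually_lt_const (by rw [hcdef]; linarith)
  obtain ⟨N₀, hN₀⟩ := eventually_atTop.1 hev
  have ht : Tendsto (fun n => |S n - s|) atTop (𝓝 0) := by
    refine contract_lemma _ (fun n => (|ε (n + 1)| * (A n + 1) + s * |ε n|) / B n) c (1 + s) 2 N₀
      (by rw [hcdef]; positivity) hc1 (fun n => abs_nonneg _) ?_ ?_ ?_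
    · intro n
      rw [abs_le]; constructor <;> linarith [(h01 n).1, (h01 n).2]
    · have e1 : Tendsto (fun n => |ε n|) atTop (𝓝 0) := by simpa using hεt.abs
      have e2 := e1.comp (tendsto_add_atTop_nat 1)
      have := ((e2.mul (hAa.add_const 1)).add (e1.const_mul s)).div hBb hb.ne'
      simp only [zero_mul, mul_zero, add_zero, zero_div] at this
      exact this
    · intro n hn
      have hBn := hB n
      have e1 := hstep n
      have e2 := hstep (n + 1)
      have e3 := hprod n
      have hp : 0 < A n + S n := by linarith [hA n, (h01 n).1]
      have e4 : B n * |S (n + 2) - s| ≤ |ε (n + 1)| * (A n + 1) + s * |ε n| + s * s * |S n - s| := by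
        calc B n * |S (n + 2) - s| ≤ (A (n + 1) + S (n + 1)) * (A n + S n) * |S (n + 2) - s| :=
              mul_le_mul_of_nonneg_right e3 (abs_nonneg _)
          _ = (A n + S n) * ((A (n + 1) + S (n + 1)) * |S (n + 1 + 1) - s|) := by ring_nf
          _ ≤ (A n + S n) * (|ε (n + 1)| + s * |S (n + 1) - s|) :=
              mul_le_mul_of_nonneg_left e2 hp.le
          _ = |ε (n + 1)| * (A n + S n) + s * ((A n + S n) * |S (n + 1) - s|) := by ring
          _ ≤ |ε (n + 1)| * (A n + 1) + s * (|ε n| + s * |S n - s|) := by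
              gcongr
              exact (h01 n).2
          _ = _ := by ring
      have e5 : |S (n + 2) - s| ≤ (|ε (n + 1)| * (A n + 1) + s * |ε n| + s * s * |S n - s|) / B n := by
        rw [le_div_iff₀ hBn]; linarith
      have e6 := mul_le_mul_of_nonneg_right (hN₀ n hn).le (abs_nonneg (S n - s))
      calc _ ≤ _ := e5
        _ = s * s / B n * |S n - s| + (|ε (n + 1)| * (A n + 1) + s * |ε n|) / B n := by ring
        _ ≤ _ := by linarith
  have := tendsto_zero_iff_abs_tendsto_zero (fun n => S n - s) |>.2 ht
  simpa using this.add_const s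

lemma R_limit (S R : ℕ → ℝ) (s : ℝ) (hs0 : 0 < s) (hs1 : s < 1)
    (h01 : ∀ n, 0 ≤ S n ∧ S n ≤ 1) (hS : Tendsto S atTop (𝓝 s))
    (R0 : R 0 = 1) (hR : ∀ n, R (n + 1) = 1 - S n * R n) :
    Tendsto R atTop (𝓝 (1 / (1 + s))) := by
  have hR01 : ∀ n, 0 ≤ R n ∧ R n ≤ 1 := by
    intro n
    induction n with
    | zero => simp [R0]
    | succ n ih =>
      rw [hR]
      constructor <;> nlinarith [(h01 n).1, (h01 n).2, mul_nonneg (h01 n).1 ih.1, mul_le_one₀ (h01 n).2 ih.1 ih.2]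
  set r := 1 / (1 + s) with hr
  have hr0 : 0 < r := by positivity
  have hr1 : r ≤ 1 := by rw [hr, div_le_one (by linarith)]; linarith
  have hrs : 1 - r - s * r = 0 := by rw [hr]; field_simp; ring
  obtain ⟨N₀, hN₀⟩ := eventually_atTop.1
    (hS.eventually_lt_const (show s < (s + 1) / 2 by linarith))
  have ht : Tendsto (fun n => |R n - r|) atTop (𝓝 0) := by
    refine contract_lemma _ (fun n => |1 - r - S n * r|) ((s + 1) / 2) 1 1 N₀
      (by linarith) (by linarith) (fun n => abs_nonneg _) ?_ ?_ ?_
    · intro n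
      rw [abs_le]; constructor <;> linarith [(hR01 n).1, (hR01 n).2]
    · have := ((hS.mul_const r).const_sub (1 - r)).abs
      rwa [hrs, abs_zero] at this
    · intro n hn
      have e : R (n + 1) - r = (1 - r - S n * r) - S n * (R n - r) := by rw [hR]; ring
      rw [e]
      have := abs_sub (1 - r - S n * r) (S n * (R n - r))
      rw [abs_mul, abs_of_nonneg (h01 n).1] at this
      have := mul_le_mul_of_nonneg_right (hN₀ n hn).le (abs_nonneg (R n - r))
      linarith
  have := tendsto_zero_iff_abs_tendsto_zero (fun n => R n - r) |>.2 ht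
  simpa using this.add_const r

/-- Probability that the walk stays below `m` before time `t` and is at `x` at time `t`. -/
def Wset (m t x : ℕ) : Set (ℕ → ℕ) := {ω | (∀ i < t, ω i < m) ∧ ω t = x}

lemma Wset_meas (m t x : ℕ) : MeasurableSet (Wset m t x) := by
  unfold Wset
  measurability

lemma markov_step (μ : Measure (ℕ → ℕ)) (p : ℕ → ℕ → ℝ) (init : ℕ)
    (hμ : IsMarkovChain μ p init) (m t x y : ℕ) :
    μ (Wset m t x ∩ {ω | ω (t + 1) = y}) = ENNReal.ofReal (p x y) * μ (Wset m t x) := by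
  let r : (ℕ → ℕ) → (Fin (t + 1) → ℕ) := fun ω i => ω i
  have hr : Measurable r := by fun_prop
  let A : Set (Fin (t + 1) → ℕ) := {h | (∀ i : Fin (t + 1), (i : ℕ) < t → h i < m) ∧ h (Fin.last t) = x}
  have hA : Wset m t x = r ⁻¹' A := by
    ext ω
    simp only [Wset, Set.mem_ofPred_eq, Set.mem_preimage, A, r, Fin.val_last]
    refine and_congr_left fun _ => ⟨fun h i hi => h i hi, fun h i hi => h ⟨i, by omega⟩ hi⟩
  have hAc : A.Countable := Set.to_countable A
  have hy : MeasurableSet {ω : ℕ → ℕ | ω (t + 1) = y} := by measurability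
  have hm : ∀ h ∈ A, MeasurableSet (r ⁻¹' {h}) := fun h _ => hr (measurableSet_singleton h)
  have e1 := tsum_measure_preimage_singleton (μ := μ) hAc hm
  have e2 := tsum_measure_preimage_singleton (μ := μ.restrict {ω : ℕ → ℕ | ω (t + 1) = y}) hAc hm
  rw [Measure.restrict_apply (hA ▸ Wset_meas m t x)] at e2
  rw [hA, ← e2, ← e1, ← ENNReal.tsum_mul_left]
  refine tsum_congr fun h => ?_
  rw [Measure.restrict_apply (hm h h.2)]
  have hh := hμ.2 t (fun i => if hi : i < t + 1 then h.1 ⟨i, hi⟩ else 0) y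
  have c : {ω : ℕ → ℕ | ∀ i ≤ t, ω i = (fun i => if hi : i < t + 1 then h.1 ⟨i, hi⟩ else 0) i}
      = r ⁻¹' {h.1} := by
    ext ω
    simp only [Set.mem_ofPred_eq, Set.mem_preimage, Set.mem_singleton_iff, r, funext_iff]
    constructor
    · intro H i
      have := H i (by omega)
      rw [dif_pos i.2] at this
      exact this
    · intro H i hi
      have := H ⟨i, by omega⟩
      rw [dif_pos (by omega)]
      exact this
  rw [Set.ofPred_and, c] at hh
  have hx : (fun i => if hi : i < t + 1 then h.1 ⟨i, hi⟩ else 0) t = x := by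
    have := h.2.2
    simp only [Fin.last] at this
    simpa using this
  have hh' := hh
  rw [show (if hi : t < t + 1 then h.1 ⟨t, hi⟩ else 0) = x from hx] at hh'
  exact hh'

lemma W_succ (μ : Measure (ℕ → ℕ)) [IsProbabilityMeasure μ] (p : ℕ → ℕ → ℝ) (init : ℕ)
    (hp : ∀ x y, 0 ≤ p x y)
    (hμ : IsMarkovChain μ p init) (m t y : ℕ) :
    μ.real (Wset m (t + 1) y) = ∑ x ∈ Finset.range m, μ.real (Wset m t x) * p x y := by
  have e : Wset m (t + 1) y = ⋃ x ∈ Finset.range m, Wset m t x ∩ {ω | ω (t + 1) = y} := by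
    ext ω
    simp only [Wset, Set.mem_ofPred_eq, Set.mem_iUnion, Finset.mem_range, Set.mem_inter_iff]
    constructor
    · rintro ⟨h1, h2⟩
      exact ⟨ω t, h1 t (by omega), ⟨fun i hi => h1 i (by omega), rfl⟩, h2⟩
    · rintro ⟨x, hx, ⟨h1, h2⟩, h3⟩
      refine ⟨fun i hi => ?_, h3⟩
      rcases Nat.lt_succ_iff_lt_or_eq.1 hi with h | rfl
      · exact h1 i h
      · omega
  rw [e, measureReal_biUnion_finset]
  · refine Finset.sum_congr rfl fun x _ => ?_
    rw [measureReal_def, markov_step μ p init hμ, ENNReal.toReal_mul,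
      ENNReal.toReal_ofReal (hp x y), mul_comm, measureReal_def]
  · intro x _ x' _ hxx
    rw [Function.onFun, Set.disjoint_left]
    rintro ω ⟨⟨_, h⟩, _⟩ ⟨⟨_, h'⟩, _⟩
    exact hxx (h.symm.trans h')
  · intro x _
    exact (Wset_meas m t x).inter (by measurability)

lemma transY_nonneg (q p1 p2 : ℕ → ℝ)
    (hq : ∀ k, 2 ≤ k → 0 < q k) (hp1 : ∀ k, 2 ≤ k → 0 ≤ p1 k)
    (hp2 : ∀ k, 2 ≤ k → 0 < p2 k) (x y : ℕ) : 0 ≤ transY q p1 p2 x y := by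
  unfold transY
  split_ifs with h0 h1 h2 h3 h4 h5 h6 <;> try norm_num
  · exact (hq x (by omega)).le
  · exact hp1 x (by omega)
  · exact (hp2 x (by omega)).le

/-- generator applied to a function -/
lemma transY_sum (q p1 p2 f : ℕ → ℝ) (c : ℝ) (m x : ℕ) (hm : 3 ≤ m) (hx : x < m)
    (f02 : f 2 = f 0 + c) (f10 : f 0 = f 1 + c)
    (hf : ∀ n, q (n + 2) * f (n + 1) + p1 (n + 2) * f (n + 3) + p2 (n + 2) * f (n + 4)
      = f (n + 2) + c) :
    ∑ y ∈ Finset.range (m + 2), transY q p1 p2 x y * f y = f x + c := by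
  rcases x with _ | _ | x
  · rw [Finset.sum_eq_single 2]
    · simp [transY, f02]
    · intro y _ hy; simp [transY, hy]
    · intro h; simp only [Finset.mem_range] at h; omega
  · rw [Finset.sum_eq_single 0]
    · simp [transY, f10]
    · intro y _ hy; simp [transY, hy]
    · intro h; simp at h
  · rw [← hf x]
    have hsub : ({x + 1, x + 3, x + 4} : Finset ℕ) ⊆ Finset.range (m + 2) := by
      intro y; simp only [Finset.mem_insert, Finset.mem_singleton, Finset.mem_range]; omega
    rw [← Finset.sum_subset hsub]
    · rw [Finset.sum_insert (by simp), Finset.sum_insert (by simp), Finset.sum_singleton]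
      simp [transY]
      ring
    · intro y _ hy
      simp only [Finset.mem_insert, Finset.mem_singleton, not_or] at hy
      have h1 : y ≠ x + 1 + 1 - 1 := by omega
      have h2 : y ≠ x + 1 + 1 + 1 := by omega
      have h3 : y ≠ x + 1 + 1 + 2 := by omega
      unfold transY
      rw [if_neg (by omega), if_neg (by omega), if_neg h1, if_neg h2, if_neg h3, zero_mul]

lemma exists_sol (q p1 p2 : ℕ → ℝ) (hp2 : ∀ k, 2 ≤ k → 0 < p2 k) (c : ℝ) :
    ∃ f : ℕ → ℝ, f 0 = 0 ∧ f 1 = -c ∧ f 2 = c ∧ f 3 = 1 ∧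
      ∀ n, q (n + 2) * f (n + 1) + p1 (n + 2) * f (n + 3) + p2 (n + 2) * f (n + 4)
        = f (n + 2) + c := by
  let g : ℕ → ℝ × ℝ × ℝ := fun n => Nat.rec (-c, c, 1) (fun n v =>
    (v.2.1, v.2.2, (v.2.1 + c - q (n + 2) * v.1 - p1 (n + 2) * v.2.2) / p2 (n + 2))) n
  have hg : ∀ n, g (n + 1) = ((g n).2.1, (g n).2.2,
    ((g n).2.1 + c - q (n + 2) * (g n).1 - p1 (n + 2) * (g n).2.2) / p2 (n + 2)) := fun n => rfl
  refine ⟨fun n => Nat.casesOn n 0 (fun k => (g k).1), rfl, rfl, rfl, rfl, fun n => ?_⟩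
  have h := hp2 (n + 2) (by omega)
  change q (n + 2) * (g n).1 + p1 (n + 2) * (g (n + 1 + 1)).1 + p2 (n + 2) * (g (n + 1 + 1 + 1)).1
    = (g (n + 1)).1 + c
  simp only [hg]
  field_simp
  ring

/-- Key identity from optional stopping. -/
lemma exit_identity
    (q p1 p2 : ℕ → ℝ)
    (hq : ∀ k, 2 ≤ k → 0 < q k) (hp1 : ∀ k, 2 ≤ k → 0 ≤ p1 k)
    (hp2 : ∀ k, 2 ≤ k → 0 < p2 k)
    (hsum : ∀ k, 2 ≤ k → q k + p1 k + p2 k = 1)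
    (μ : Measure (ℕ → ℕ)) [IsProbabilityMeasure μ]
    (hμ : IsMarkovChain μ (transY q p1 p2) 2) (m : ℕ) (hm : 3 ≤ m)
    (H : ℕ → ℝ) (H0 : H 0 = 0) (H1 : H 1 = 0) (H2 : H 2 = 0)
    (hH : ∀ n, q (n + 2) * H (n + 1) + p1 (n + 2) * H (n + 3) + p2 (n + 2) * H (n + 4)
        = H (n + 2)) :
    ∃ A B : ℝ, A + B = 1 ∧ A * H m + B * H (m + 1) = 0 ∧
      A = μ.real (⋃ t, Wset m t m) ∧ B = μ.real (⋃ t, Wset m t (m + 1)) := by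
  set W : ℕ → ℕ → ℝ := fun t x => μ.real (Wset m t x) with hW
  have hW0 : ∀ t x, 0 ≤ W t x := fun t x => measureReal_nonneg
  have hWs : ∀ t y, W (t + 1) y = ∑ x ∈ Finset.range m, W t x * transY q p1 p2 x y := fun t y =>
    W_succ μ _ 2 (transY_nonneg q p1 p2 hq hp1 hp2) hμ m t y
  have hinit : ∀ x, W 0 x = if x = 2 then 1 else 0 := by
    intro x
    have e : Wset m 0 x = {ω | ω 0 = x} := by simp [Wset]
    simp only [hW, e]
    split_ifs with h
    · subst h; rw [measureReal_def, hμ.1]; simp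
    · have h2 : MeasurableSet {ω : ℕ → ℕ | ω 0 = 2} := by measurability
      have : μ {ω : ℕ → ℕ | ω 0 = 2}ᶜ = 0 := (prob_compl_eq_zero_iff h2).2 hμ.1
      rw [measureReal_def, measure_mono_null _ this, ENNReal.toReal_zero]
      intro ω hω; simp only [Set.mem_ofPred_eq, Set.mem_compl_iff] at *; omega
  let S : (ℕ → ℝ) → ℕ → ℝ := fun f t => ∑ x ∈ Finset.range m, W t x * f x +
    ((∑ i ∈ Finset.range (t + 1), W i m) * f m + (∑ i ∈ Finset.range (t + 1), W i (m + 1)) * f (m + 1))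
  have hS0 : ∀ f : ℕ → ℝ, S f 0 = f 2 := by
    intro f
    have h2 : m ≠ 2 := by omega
    have h3 : m + 1 ≠ 2 := by omega
    simp only [S, hinit, zero_add, Finset.sum_range_one, if_neg h2, if_neg h3]
    rw [Finset.sum_eq_single 2]
    · simp
    · intro y _ hy; simp [hy]
    · intro h; simp only [Finset.mem_range] at h; omega
  have hSs : ∀ (f : ℕ → ℝ) (c : ℝ), f 2 = f 0 + c → f 0 = f 1 + c →
    (∀ n, q (n + 2) * f (n + 1) + p1 (n + 2) * f (n + 3) + p2 (n + 2) * f (n + 4)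
      = f (n + 2) + c) → ∀ t, S f (t + 1) = S f t + c * ∑ x ∈ Finset.range m, W t x := by
    intro f c h1 h2 h3 t
    have e : ∑ y ∈ Finset.range (m + 2), W (t + 1) y * f y
        = ∑ x ∈ Finset.range m, W t x * f x + c * ∑ x ∈ Finset.range m, W t x := by
      simp only [hWs, Finset.sum_mul]
      rw [Finset.sum_comm, Finset.mul_sum, ← Finset.sum_add_distrib]
      refine Finset.sum_congr rfl fun x hx => ?_
      have := transY_sum q p1 p2 f c m x hm (Finset.mem_range.1 hx) h1 h2 h3
      simp only [mul_assoc]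
      rw [← Finset.mul_sum, this]; ring
    rw [Finset.sum_range_succ, Finset.sum_range_succ] at e
    simp only [S]
    rw [Finset.sum_range_succ (fun i => W i m) (t + 1), Finset.sum_range_succ (fun i => W i (m + 1)) (t + 1)]
    linarith
  have hone : ∀ t, S (fun _ => 1) t = 1 := by
    intro t
    induction t with
    | zero => exact hS0 _
    | succ t ih =>
      rw [hSs (fun _ => 1) 0 (by simp) (by simp) (fun n => by
        have := hsum (n + 2) (by omega); linarith), ih]; simp
  have hHt : ∀ t, S H t = 0 := by
    intro t
    induction t with
    | zero => rw [hS0, H2]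
    | succ t ih =>
      rw [hSs H 0 (by rw [H0, H2]; simp) (by rw [H0, H1]; simp) (fun n => by
        rw [hH n]; simp), ih]; simp
  -- survival probability tends to zero
  set V : ℕ → ℝ := fun t => ∑ x ∈ Finset.range m, W t x with hV
  have hV0 : ∀ t, 0 ≤ V t := fun t => Finset.sum_nonneg fun x _ => hW0 t x
  obtain ⟨f, f0, f1, f2, f3, hf⟩ := exists_sol q p1 p2 hp2 1
  have hVsum : Summable V := by
    set M := ∑ x ∈ Finset.range (m + 2), |f x| with hM
    have hfM : ∀ x < m + 2, f x ≤ M := fun x hx => (le_abs_self _).trans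
      (Finset.single_le_sum (f := fun x => |f x|) (fun i _ => abs_nonneg _) (Finset.mem_range.2 hx))
    have hSM : ∀ t, S f t ≤ M := by
      intro t
      have := hone t
      simp only [S, mul_one] at this
      have a1 : ∑ x ∈ Finset.range m, W t x * f x ≤ (∑ x ∈ Finset.range m, W t x) * M := by
        rw [Finset.sum_mul]
        refine Finset.sum_le_sum fun x hx => mul_le_mul_of_nonneg_left (hfM x ?_) (hW0 t x)
        have := Finset.mem_range.1 hx; omega
      have a2 := mul_le_mul_of_nonneg_left (hfM m (by omega))
        (Finset.sum_nonneg (s := Finset.range (t + 1)) fun i _ => hW0 i m)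
      have a3 := mul_le_mul_of_nonneg_left (hfM (m + 1) (by omega))
        (Finset.sum_nonneg (s := Finset.range (t + 1)) fun i _ => hW0 i (m + 1))
      have a4 := congrArg (· * M) this
      simp only [S]
      simp only [add_mul, one_mul] at a4
      linarith
    have hSV : ∀ t, S f t = f 2 + ∑ i ∈ Finset.range t, V i := by
      intro t
      induction t with
      | zero => simp [hS0]
      | succ t ih =>
        rw [hSs f 1 (by rw [f0, f2]; simp) (by rw [f0, f1]; simp) hf, ih, Finset.sum_range_succ]
        ring
    refine summable_of_sum_range_le hV0 (c := M - f 2) fun t => ?_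
    have := hSM t; have := hSV t; linarith
  have hVt : Tendsto V atTop (𝓝 0) := hVsum.tendsto_atTop_zero
  have hWt : ∀ x ∈ Finset.range m, Tendsto (fun t => W t x) atTop (𝓝 0) := fun x hx =>
    squeeze_zero (fun t => hW0 t x)
      (fun t => Finset.single_le_sum (f := fun x => W t x) (fun i _ => hW0 t i) hx) hVt
  have hWf : ∀ g : ℕ → ℝ, Tendsto (fun t => ∑ x ∈ Finset.range m, W t x * g x) atTop (𝓝 0) := by
    intro g
    have := tendsto_finsetSum (Finset.range m) (fun x hx => (hWt x hx).mul_const (g x))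
    simpa using this
  have hsumW : ∀ y, m ≤ y → Tendsto (fun t => ∑ i ∈ Finset.range (t + 1), W i y) atTop
      (𝓝 (μ.real (⋃ t, Wset m t y))) := by
    intro y hy
    have hd : Pairwise (Function.onFun Disjoint fun t => Wset m t y) := by
      have key : ∀ s t, s < t → Disjoint (Wset m s y) (Wset m t y) := by
        intro s t hst
        rw [Set.disjoint_left]
        rintro ω ⟨_, h⟩ ⟨h', _⟩
        have := h' s hst; omega
      intro s t hst
      rcases lt_or_gt_of_ne hst with h | h
      · exact key s t h
      · exact (key t s h).symm
    have e := measure_iUnion (μ := μ) hd (fun t => Wset_meas m t y)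
    have hne : ∑' t, μ (Wset m t y) ≠ ∞ := by rw [← e]; exact measure_ne_top _ _
    have hs := ENNReal.hasSum_toReal hne
    rw [← ENNReal.tsum_toReal_eq (fun t => measure_ne_top _ _), ← e] at hs
    exact hs.tendsto_sum_nat.comp (tendsto_add_atTop_nat 1)
  have hlim : ∀ g : ℕ → ℝ, Tendsto (S g) atTop
      (𝓝 (0 + (μ.real (⋃ t, Wset m t m) * g m + μ.real (⋃ t, Wset m t (m + 1)) * g (m + 1)))) :=
    fun g => (hWf g).add (((hsumW m le_rfl).mul_const _).add ((hsumW (m + 1) (by omega)).mul_const _))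
  refine ⟨_, _, ?_, ?_, rfl, rfl⟩
  · have := tendsto_nhds_unique (hlim fun _ => 1) (by
      rw [show S (fun _ => 1) = fun _ => 1 from funext hone]; exact tendsto_const_nhds)
    simpa using this
  · have := tendsto_nhds_unique (hlim H) (by
      rw [show S H = fun _ => 0 from funext hHt]; exact tendsto_const_nhds)
    simpa using this

lemma event_eq (μ : Measure (ℕ → ℕ)) [IsProbabilityMeasure μ] (m : ℕ)
    (h : μ.real (⋃ t, Wset m t m) + μ.real (⋃ t, Wset m t (m + 1)) = 1) :
    (μ {ω | ∃ t, ω t = m + 1 ∧ ∀ i < t, ω i ≠ m ∧ ω i ≠ m + 1}).toReal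
      = μ.real (⋃ t, Wset m t (m + 1)) := by
  set E := {ω : ℕ → ℕ | ∃ t, ω t = m + 1 ∧ ∀ i < t, ω i ≠ m ∧ ω i ≠ m + 1} with hE
  change μ.real E = _
  have hG : MeasurableSet (⋃ t, Wset m t m) := MeasurableSet.iUnion fun t => Wset_meas m t m
  apply le_antisymm
  · have h1 : E ⊆ (⋃ t, Wset m t m)ᶜ := by
      rintro ω ⟨t, ht, hi⟩ hω
      obtain ⟨s, hs1, hs2⟩ := Set.mem_iUnion.1 hω
      rcases lt_trichotomy s t with hst | rfl | hst
      · exact (hi s hst).1 hs2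
      · omega
      · have := hs1 t hst; omega
    have h2 := measureReal_mono (μ := μ) h1
    rw [probReal_compl_eq_one_sub hG] at h2
    linarith
  · refine measureReal_mono ?_
    intro ω hω
    obtain ⟨s, hs1, hs2⟩ := Set.mem_iUnion.1 hω
    exact ⟨s, hs2, fun i hi => by have := hs1 i hi; omega⟩


theorem h_limit
    (q p1 p2 : ℕ → ℝ)
    (hq : ∀ k, 2 ≤ k → 0 < q k) (hp1 : ∀ k, 2 ≤ k → 0 ≤ p1 k)
    (hp2 : ∀ k, 2 ≤ k → 0 < p2 k)
    (hsum : ∀ k, 2 ≤ k → q k + p1 k + p2 k = 1)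
    (μ : Measure (ℕ → ℕ)) [IsProbabilityMeasure μ]
    (hμ : IsMarkovChain μ (transY q p1 p2) 2)
    (a b : ℝ) (ha : 0 < a) (hb : 0 < b)
    (hCa : Tendsto (fun k => (p1 k + p2 k) / q k) atTop (𝓝 a))
    (hCb : Tendsto (fun k => p2 k / q k) atTop (𝓝 b))
    (σ : ℝ) (hσ : σ = (a - Real.sqrt (a ^ 2 + 4 * b)) / 2) :
    Tendsto
      (fun k : ℕ =>
        (μ {ω | ∃ t, ω t = 2 * k + 1 ∧
            ∀ i < t, ω i ≠ 2 * k ∧ ω i ≠ 2 * k + 1}).toReal)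
      atTop (𝓝 (-σ / (1 - σ))) := by
  set A : ℕ → ℝ := fun n => (p1 (n + 2) + p2 (n + 2)) / q (n + 2) with hAdef
  set B : ℕ → ℝ := fun n => p2 (n + 2) / q (n + 2) with hBdef
  have hq' : ∀ n, 0 < q (n + 2) := fun n => hq _ (by omega)
  have hp1' : ∀ n, 0 ≤ p1 (n + 2) := fun n => hp1 _ (by omega)
  have hp2' : ∀ n, 0 < p2 (n + 2) := fun n => hp2 _ (by omega)
  have hA : ∀ n, 0 < A n := fun n => div_pos (by linarith [hp1' n, hp2' n]) (hq' n)
  have hB : ∀ n, 0 < B n := fun n => div_pos (hp2' n) (hq' n)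
  have hBA : ∀ n, B n ≤ A n := fun n =>
    div_le_div_of_nonneg_right (by linarith [hp1' n]) (hq' n).le
  have hAt : Tendsto A atTop (𝓝 a) := hCa.comp (tendsto_add_atTop_nat 2)
  have hBt : Tendsto B atTop (𝓝 b) := hCb.comp (tendsto_add_atTop_nat 2)
  have hba : b ≤ a := le_of_tendsto_of_tendsto' hBt hAt hBA
  obtain ⟨s, hs⟩ : ∃ s, s = -σ := ⟨_, rfl⟩
  have hsq : Real.sqrt (a ^ 2 + 4 * b) * Real.sqrt (a ^ 2 + 4 * b) = a ^ 2 + 4 * b :=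
    Real.mul_self_sqrt (by positivity)
  have hsq0 := Real.sqrt_nonneg (a ^ 2 + 4 * b)
  have hs2 : s * s + a * s = b := by
    rw [hs, hσ]; nlinarith
  have hs0 : 0 < s := by
    rw [hs, hσ]; nlinarith
  have hs1 : s < 1 := by nlinarith
  let S : ℕ → ℝ := fun n => Nat.rec 0 (fun n v => B n / (A n + v)) n
  have S0 : S 0 = 0 := rfl
  have hS : ∀ n, S (n + 1) = B n / (A n + S n) := fun n => rfl
  let R : ℕ → ℝ := fun n => Nat.rec 1 (fun n v => 1 - S n * v) n
  have R0 : R 0 = 1 := rfl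
  have hR : ∀ n, R (n + 1) = 1 - S n * R n := fun n => rfl
  obtain ⟨h01, hSt⟩ := cf_limit A B a b s hA hB hBA hb ha hAt hBt hs0 hs2 S S0 hS
  have hRt := R_limit S R s hs0 hs1 h01 hSt R0 hR
  obtain ⟨H, H0, H1, H2, H3, hH⟩ := exists_sol q p1 p2 hp2 0
  simp only [neg_zero, add_zero] at H1 hH
  have hrel : ∀ n, H (n + 3) - H (n + 2) ≠ 0 ∧
      H (n + 2) - H (n + 1) = - S n * (H (n + 3) - H (n + 2)) ∧
      H (n + 2) = R n * (H (n + 2) - H (n + 1)) := by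
    intro n
    induction n with
    | zero => simp [H1, H2, H3, S0]
    | succ n ih =>
      obtain ⟨i1, i2, i3⟩ := ih
      have hqn := hq' n
      have hpos : 0 < A n + S n := by linarith [hA n, (h01 n).1]
      have hd : B n * (H (n + 4) - H (n + 3)) = -(S n + A n) * (H (n + 3) - H (n + 2)) := by
        have e1 := hH n
        have e2 := hsum (n + 2) (by omega)
        have e3 : H (n + 2) - H (n + 1) = A n * (H (n + 3) - H (n + 2)) + B n * (H (n + 4) - H (n + 3)) := by
          simp only [hAdef, hBdef]
          field_simp
          have e4 : q (n + 2) = 1 - p1 (n + 2) - p2 (n + 2) := by linarith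
          rw [e4] at e1 ⊢
          linarith
        linarith
      refine ⟨?_, ?_, ?_⟩
      · intro h0
        change H (n + 4) - H (n + 3) = 0 at h0
        rw [h0, mul_zero] at hd
        rcases mul_eq_zero.1 hd.symm with h | h
        · linarith
        · exact i1 h
      · change H (n + 3) - H (n + 2) = - S (n + 1) * (H (n + 4) - H (n + 3))
        rw [hS]
        field_simp
        linarith
      · change H (n + 3) = R (n + 1) * (H (n + 3) - H (n + 2))
        rw [hR]
        rw [i2] at i3
        linarith
  have hval : ∀ n, 1 ≤ n → (μ {ω | ∃ t, ω t = (n + 2) + 1 ∧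
      ∀ i < t, ω i ≠ (n + 2) ∧ ω i ≠ (n + 2) + 1}).toReal = S n * R n := by
    intro n hn
    obtain ⟨X, Y, h1, h2, rfl, rfl⟩ := exit_identity q p1 p2 hq hp1 hp2 hsum μ hμ (n + 2) (by omega)
      H H0 H1 H2 hH
    rw [event_eq μ (n + 2) h1]
    obtain ⟨i1, i2, i3⟩ := hrel n
    apply mul_right_cancel₀ i1
    rw [i2] at i3
    have hX := eq_sub_of_add_eq h1
    rw [hX] at h2
    change _ * H (n + 2) + _ * H (n + 3) = 0 at h2
    linarith
  have hfin : Tendsto (fun n => S n * R n) atTop (𝓝 (-σ / (1 - σ))) := by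
    have := hSt.mul hRt
    have e : s * (1 / (1 + s)) = -σ / (1 - σ) := by rw [hs]; ring
    rwa [e] at this
  have hsub : Tendsto (fun k : ℕ => 2 * k - 2) atTop atTop :=
    tendsto_atTop_mono (fun k => show k - 2 ≤ 2 * k - 2 by omega) (tendsto_sub_atTop_nat 2)
  refine (hfin.comp hsub).congr' ?_
  filter_upwards [eventually_ge_atTop 2] with k hk
  have := hval (2 * k - 2) (by omega)
  rw [show 2 * k - 2 + 2 = 2 * k by omega] at this
  exact this.symm


end
end

section
/- For all integers 1 ≤ m < k < n, the probability P_k(m,n,−) that the (2,1) random walk X started at X₀ = k hits the set [0,m] before it hits [n,∞) equals (Σ_{s=k}^{n−1} e₁ A_s A_{s−1}⋯A_{m+1} e₁ᵗ) / (1 + Σ_{s=m+1}^{n−1} e₁ A_s A_{s−1}⋯A_{m+1} e₁ᵗ), where the matrix products are taken with indices decreasing from s down to m+1. -/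
open Filter MeasureTheory ENNReal Topology

noncomputable section

/-- Transition function of the (2,1) random walk `X`. -/
def transX (q p1 p2 : ℕ → ℝ) (n j : ℕ) : ℝ :=
  if n = 0 then (if j = 1 then 1 else 0)
  else if n = 1 then (if j = 2 then 1 else 0)
  else if j = n + 1 then q n
  else if j = n - 1 then p1 n
  else if j = n - 2 then p2 n
  else 0

/-- The matrix `A_k` with first row `(a_k, b_k)` and second row `(1, 0)`. -/
def Amat (q p1 p2 : ℕ → ℝ) (k : ℕ) : Matrix (Fin 2) (Fin 2) ℝ :=
  !![(p1 k + p2 k) / q k, p2 k / q k; 1, 0]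

/-- The ordered product `A_s A_{s-1} ⋯ A_{m+1}`, indices decreasing from `s`
down to `m+1` (identity when `s ≤ m`). -/
def prodDesc (q p1 p2 : ℕ → ℝ) (s m : ℕ) : Matrix (Fin 2) (Fin 2) ℝ :=
  ((List.range (s - m)).map fun i => Amat q p1 p2 (s - i)).prod

/-- Path exits at time `t` at `j`, staying in `(m,n)` before. -/
def Eev (m n t j : ℕ) : Set (ℕ → ℕ) := {ω | ω t = j ∧ ∀ i < t, m < ω i ∧ ω i < n}

lemma meas_Eev (m n t j : ℕ) : MeasurableSet (Eev m n t j) := by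
  unfold Eev
  have h1 : ∀ s (A : Set ℕ), MeasurableSet {ω : ℕ → ℕ | ω s ∈ A} := fun s A =>
    measurable_pi_apply s (MeasurableSet.of_discrete (s := A))
  have h2 : {ω : ℕ → ℕ | ω t = j ∧ ∀ i < t, m < ω i ∧ ω i < n}
      = {ω | ω t ∈ ({j} : Set ℕ)} ∩ ⋂ i, ⋂ (_ : i < t), {ω | ω i ∈ Set.Ioo m n} := by
    ext ω; simp
  rw [h2]
  exact (h1 _ _).inter (MeasurableSet.iInter fun i => MeasurableSet.iInter fun _ => h1 _ _)

/-- restriction to first coordinates -/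
def prj (t : ℕ) (ω : ℕ → ℕ) : Fin (t + 1) → ℕ := fun i => ω i

lemma meas_prj (t : ℕ) : Measurable (prj t) :=
  measurable_pi_lambda _ fun i => measurable_pi_apply _

lemma markov_step_s13 (μ : Measure (ℕ → ℕ)) [IsProbabilityMeasure μ] (p : ℕ → ℕ → ℝ) (x0 : ℕ)
    (h : IsMarkovChain μ p x0) (t i j : ℕ) (S : Set (Fin (t + 1) → ℕ)) :
    μ (prj t ⁻¹' S ∩ {ω | ω t = i ∧ ω (t + 1) = j})
      = ENNReal.ofReal (p i j) * μ (prj t ⁻¹' S ∩ {ω | ω t = i}) := by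
  have key : (μ.restrict {ω | ω t = i ∧ ω (t + 1) = j}).map (prj t)
      = ENNReal.ofReal (p i j) • (μ.restrict {ω | ω t = i}).map (prj t) := by
    refine Measure.ext_of_singleton fun y => ?_
    rw [Measure.smul_apply, Measure.map_apply (meas_prj t) (measurableSet_singleton _),
      Measure.map_apply (meas_prj t) (measurableSet_singleton _),
      Measure.restrict_apply (meas_prj t (measurableSet_singleton _)),
      Measure.restrict_apply (meas_prj t (measurableSet_singleton _)), smul_eq_mul]
    by_cases hy : y (Fin.last t) = i
    · have h1 := h.2 t (fun s => if hs : s < t + 1 then y ⟨s, hs⟩ else 0) j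
      have e0 : ∀ ω : ℕ → ℕ, prj t ω = y ↔
          ∀ s ≤ t, ω s = if hs : s < t + 1 then y ⟨s, hs⟩ else 0 := by
        intro ω
        constructor
        · rintro rfl s hs
          simp [prj, Nat.lt_succ_of_le hs]
        · intro hh
          funext s
          have := hh s (Nat.le_of_lt_succ s.2)
          rw [dif_pos s.2] at this
          exact this
      have e2 : prj t ⁻¹' {y} ∩ {ω | ω t = i}
          = {ω | ∀ s ≤ t, ω s = if hs : s < t + 1 then y ⟨s, hs⟩ else 0} := by
        ext ω
        simp only [Set.mem_inter_iff, Set.mem_preimage, Set.mem_singleton_iff, Set.mem_ofPred_eq]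
        rw [← e0]
        constructor
        · exact fun h => h.1
        · intro h
          refine ⟨h, ?_⟩
          rw [← hy, ← h]; rfl
      have e1 : prj t ⁻¹' {y} ∩ {ω | ω t = i ∧ ω (t + 1) = j}
          = {ω | (∀ s ≤ t, ω s = if hs : s < t + 1 then y ⟨s, hs⟩ else 0) ∧ ω (t + 1) = j} := by
        ext ω
        simp only [Set.mem_inter_iff, Set.mem_preimage, Set.mem_singleton_iff, Set.mem_ofPred_eq]
        rw [← e0]
        constructor
        · exact fun h => ⟨h.1, h.2.2⟩
        · rintro ⟨h, h'⟩
          refine ⟨h, ?_, h'⟩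
          rw [← hy, ← h]; rfl
      rw [e1, e2, h1]
      have : (if hs : t < t + 1 then y ⟨t, hs⟩ else 0) = i := by
        rw [dif_pos (Nat.lt_succ_self t), ← hy]; rfl
      simp only [this]
    · have e : ∀ ω : ℕ → ℕ, prj t ω = y → ω t ≠ i := by
        rintro ω rfl h
        exact hy h
      have e1 : prj t ⁻¹' {y} ∩ {ω | ω t = i ∧ ω (t + 1) = j} = ∅ := by
        ext ω; simp; intro h h'; exact absurd h' (e ω h)
      have e2 : prj t ⁻¹' {y} ∩ {ω | ω t = i} = ∅ := by
        ext ω; simp; intro h h'; exact absurd h' (e ω h)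
      rw [e1, e2]; simp
  have hS : MeasurableSet S := MeasurableSet.of_discrete
  have := congrArg (fun ν => ν S) key
  simpa only [Measure.smul_apply, Measure.map_apply (meas_prj t) hS,
    Measure.restrict_apply (meas_prj t hS), smul_eq_mul] using this

lemma Eev_step (μ : Measure (ℕ → ℕ)) [IsProbabilityMeasure μ] (p : ℕ → ℕ → ℝ) (x0 : ℕ)
    (h : IsMarkovChain μ p x0) (m n t j : ℕ) (hp : ∀ i ∈ Finset.Ioo m n, 0 ≤ p i j) :
    μ.real (Eev m n (t + 1) j)
      = ∑ i ∈ Finset.Ioo m n, μ.real (Eev m n t i) * p i j := by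
  have e : Eev m n (t + 1) j
      = ⋃ i ∈ Finset.Ioo m n, (Eev m n t i ∩ {ω | ω (t + 1) = j}) := by
    ext ω
    simp only [Eev, Set.mem_ofPred_eq, Set.mem_iUnion, Set.mem_inter_iff, Finset.mem_Ioo,
      exists_prop]
    constructor
    · rintro ⟨h1, h2⟩
      exact ⟨ω t, h2 t (Nat.lt_succ_self t), ⟨rfl, fun i hi => h2 i (by omega)⟩, h1⟩
    · rintro ⟨i, hi, ⟨rfl, h2⟩, h1⟩
      refine ⟨h1, fun s hs => ?_⟩
      rcases Nat.lt_succ_iff_lt_or_eq.mp hs with h' | rfl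
      · exact h2 s h'
      · exact hi
  have hm : MeasurableSet {ω : ℕ → ℕ | ω (t + 1) = j} :=
    measurableSet_eq_fun (measurable_pi_apply (t + 1)) measurable_const
  rw [e, measureReal_biUnion_finset]
  · refine Finset.sum_congr rfl fun i hi => ?_
    have hs := markov_step_s13 μ p x0 h t i j
      {y | ∀ s : Fin (t + 1), (s : ℕ) < t → m < y s ∧ y s < n}
    have a1 : prj t ⁻¹' {y | ∀ s : Fin (t + 1), (s : ℕ) < t → m < y s ∧ y s < n} ∩
        {ω | ω t = i} = Eev m n t i := by
      ext ω
      simp only [Eev, prj, Set.mem_inter_iff, Set.mem_preimage, Set.mem_ofPred_eq]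
      constructor
      · rintro ⟨h1, h2⟩
        exact ⟨h2, fun s hs => h1 ⟨s, by omega⟩ hs⟩
      · rintro ⟨h1, h2⟩
        exact ⟨fun s hs => h2 s hs, h1⟩
    have a2 : ∀ S : Set (ℕ → ℕ), S ∩ {ω | ω t = i ∧ ω (t + 1) = j}
        = (S ∩ {ω | ω t = i}) ∩ {ω | ω (t + 1) = j} := by
      intro S; ext ω; simp [and_assoc]
    rw [a2, a1] at hs
    rw [measureReal_def, hs, ENNReal.toReal_mul, ENNReal.toReal_ofReal (hp i hi), mul_comm]
    rfl
  · intro a _ b _ hab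
    refine Set.disjoint_left.mpr fun ω h1 h2 => hab ?_
    exact h1.1.1.symm.trans h2.1.1
  · intro i _
    exact (meas_Eev _ _ _ _).inter hm

lemma prodDesc_self (q p1 p2 : ℕ → ℝ) (m : ℕ) : prodDesc q p1 p2 m m = 1 := by
  simp [prodDesc]

lemma prodDesc_succ (q p1 p2 : ℕ → ℝ) (s m : ℕ) (h : m ≤ s) :
    prodDesc q p1 p2 (s + 1) m = Amat q p1 p2 (s + 1) * prodDesc q p1 p2 s m := by
  unfold prodDesc
  rw [Nat.succ_sub h, List.range_succ_eq_map, List.map_cons, List.prod_cons, List.map_map]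
  congr 3
  funext i
  simp

/-- the scalar sequence -/
def Dq (q p1 p2 : ℕ → ℝ) (m s : ℕ) : ℝ := if s < m then 0 else prodDesc q p1 p2 s m 0 0

lemma prodDesc_snd (q p1 p2 : ℕ → ℝ) (m s : ℕ) (h : m ≤ s) (hm : 1 ≤ m) :
    prodDesc q p1 p2 s m 1 0 = Dq q p1 p2 m (s - 1) := by
  rcases Nat.eq_or_lt_of_le h with rfl | h
  · rw [prodDesc_self, Dq, if_pos (by omega)]; simp
  · obtain ⟨s, rfl⟩ : ∃ r, s = r + 1 := ⟨s - 1, by omega⟩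
    rw [prodDesc_succ _ _ _ _ _ (by omega), Dq, if_neg (by omega)]
    simp [Amat, Matrix.mul_apply, Fin.sum_univ_two]

lemma Dq_rec (q p1 p2 : ℕ → ℝ) (m x : ℕ) (hm : 1 ≤ m) (h : m < x + 2) :
    Dq q p1 p2 m (x + 2) = (p1 (x+2) + p2 (x+2)) / q (x+2) * Dq q p1 p2 m (x + 1)
      + p2 (x+2) / q (x+2) * Dq q p1 p2 m x := by
  have := prodDesc_snd q p1 p2 m (x + 1) (by omega) hm
  rw [Nat.add_sub_cancel] at this
  rw [← this]
  unfold Dq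
  rw [if_neg (by omega), if_neg (by omega), prodDesc_succ _ _ _ _ _ (by omega)]
  simp [Amat, Matrix.mul_apply, Fin.sum_univ_two]

lemma Dq_nonneg (q p1 p2 : ℕ → ℝ) (hq : ∀ k, 2 ≤ k → 0 < q k) (hp1 : ∀ k, 2 ≤ k → 0 ≤ p1 k)
    (hp2 : ∀ k, 2 ≤ k → 0 < p2 k) (m : ℕ) (hm : 1 ≤ m) (x : ℕ) : 0 ≤ Dq q p1 p2 m x := by
  induction x using Nat.strong_induction_on with
  | _ x ih =>
    rcases Nat.lt_or_ge m x with h | h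
    · obtain ⟨y, rfl⟩ : ∃ r, x = r + 2 := ⟨x - 2, by omega⟩
      rw [Dq_rec q p1 p2 m y hm h]
      have := ih y (by omega)
      have := ih (y + 1) (by omega)
      have := hq (y + 2) (by omega)
      have := hp1 (y + 2) (by omega)
      have := hp2 (y + 2) (by omega)
      positivity
    · rcases Nat.eq_or_lt_of_le h with rfl | h
      · rw [Dq, if_neg (by omega), prodDesc_self]; simp
      · rw [Dq, if_pos h]

lemma transX_eq (q p1 p2 : ℕ → ℝ) (x j : ℕ) : transX q p1 p2 (x + 2) j =
    (if j = x + 3 then q (x+2) else 0) + (if j = x + 1 then p1 (x+2) else 0)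
      + (if j = x then p2 (x+2) else 0) := by
  unfold transX
  rw [if_neg (by omega), if_neg (by omega)]
  simp only [Nat.add_sub_cancel, show x + 2 - 1 = x + 1 from rfl]
  split_ifs <;> first | omega | simp

/-- the harmonic function -/
def fX (q p1 p2 : ℕ → ℝ) (m n x : ℕ) : ℝ :=
  (∑ s ∈ Finset.Ico x n, Dq q p1 p2 m s) / (∑ s ∈ Finset.Ico m n, Dq q p1 p2 m s)

lemma fX_harm (q p1 p2 : ℕ → ℝ) (hq : ∀ k, 2 ≤ k → 0 < q k)
    (hsum : ∀ k, 2 ≤ k → q k + p1 k + p2 k = 1) (m n : ℕ) (hm : 1 ≤ m) (i : ℕ)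
    (hi : i ∈ Finset.Ioo m n) :
    ∑ j ∈ Finset.range (n + 1), transX q p1 p2 i j * fX q p1 p2 m n j = fX q p1 p2 m n i := by
  rw [Finset.mem_Ioo] at hi
  obtain ⟨x, rfl⟩ : ∃ r, i = r + 2 := ⟨i - 2, by omega⟩
  simp only [transX_eq, add_mul, ite_mul, zero_mul, Finset.sum_add_distrib, Finset.sum_ite_eq',
    Finset.mem_range]
  rw [if_pos (by omega), if_pos (by omega), if_pos (by omega)]
  unfold fX
  rw [Finset.sum_eq_sum_Ico_succ_bot (show x < n by omega),
    Finset.sum_eq_sum_Ico_succ_bot (show x + 1 < n by omega),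
    Finset.sum_eq_sum_Ico_succ_bot (show x + 1 + 1 < n by omega),
    Dq_rec q p1 p2 m x hm hi.1]
  have h1 := hq (x + 2) (by omega)
  have h2 := hsum (x + 2) (by omega)
  have h3 : q (x + 2) = 1 - p1 (x + 2) - p2 (x + 2) := by linarith
  generalize hZ : (∑ s ∈ Finset.Ico m n, Dq q p1 p2 m s) = Z
  simp only [div_eq_mul_inv _ Z, ← mul_assoc]
  rw [← add_mul, ← add_mul]
  congr 1
  generalize (∑ s ∈ Finset.Ico (x + 1 + 1 + 1) n, Dq q p1 p2 m s) = R
  change q (x+2) * R + _ + _ = _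
  rw [show p1 (x + 2) = 1 - q (x + 2) - p2 (x + 2) by linarith]
  field_simp
  ring

lemma transX_nonneg (q p1 p2 : ℕ → ℝ)
    (hq : ∀ k, 2 ≤ k → 0 < q k) (hp1 : ∀ k, 2 ≤ k → 0 ≤ p1 k)
    (hp2 : ∀ k, 2 ≤ k → 0 < p2 k) (i j : ℕ) : 0 ≤ transX q p1 p2 i j := by
  unfold transX
  split_ifs
  any_goals norm_num
  · exact (hq i (by omega)).le
  · exact hp1 i (by omega)
  · exact (hp2 i (by omega)).le

theorem escape_probability_X
    (q p1 p2 : ℕ → ℝ)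
    (hq : ∀ k, 2 ≤ k → 0 < q k) (hp1 : ∀ k, 2 ≤ k → 0 ≤ p1 k)
    (hp2 : ∀ k, 2 ≤ k → 0 < p2 k)
    (hsum : ∀ k, 2 ≤ k → q k + p1 k + p2 k = 1)
    (μ : ℕ → Measure (ℕ → ℕ)) (hprob : ∀ x, IsProbabilityMeasure (μ x))
    (hμ : ∀ x, IsMarkovChain (μ x) (transX q p1 p2) x) :
    ∀ m k n : ℕ, 1 ≤ m → m < k → k < n →
      ((μ k) {ω | ∃ t, ω t ≤ m ∧ ∀ i < t, m < ω i ∧ ω i < n}).toReal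
        = (∑ s ∈ Finset.Icc k (n - 1), prodDesc q p1 p2 s m 0 0)
          / (1 + ∑ s ∈ Finset.Icc (m + 1) (n - 1), prodDesc q p1 p2 s m 0 0) := by
  intro m k n hm hmk hkn
  have hD0 := Dq_nonneg q p1 p2 hq hp1 hp2 m hm
  have hIcc : ∀ a, m ≤ a → ∑ s ∈ Finset.Icc a (n - 1), prodDesc q p1 p2 s m 0 0
      = ∑ s ∈ Finset.Ico a n, Dq q p1 p2 m s := by
    intro a ha
    have : Finset.Icc a (n - 1) = Finset.Ico a n := by
      ext s; simp only [Finset.mem_Icc, Finset.mem_Ico]; omega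
    rw [this]
    refine Finset.sum_congr rfl fun s hs => ?_
    rw [Finset.mem_Ico] at hs
    rw [Dq, if_neg (by omega)]
  have hZ : 1 + ∑ s ∈ Finset.Ico (m + 1) n, Dq q p1 p2 m s
      = ∑ s ∈ Finset.Ico m n, Dq q p1 p2 m s := by
    rw [Finset.sum_eq_sum_Ico_succ_bot (show m < n by omega) (Dq q p1 p2 m)]
    congr 1
    rw [Dq, if_neg (by omega), prodDesc_self]; simp
  have hZpos : 0 < ∑ s ∈ Finset.Ico m n, Dq q p1 p2 m s := by
    rw [← hZ]
    have := Finset.sum_nonneg (s := Finset.Ico (m + 1) n) fun s _ => hD0 s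
    linarith
  rw [hIcc k hmk.le, hIcc (m + 1) (by omega), hZ]
  change _ = fX q p1 p2 m n k
  have hf1 : ∀ j ≤ m, fX q p1 p2 m n j = 1 := by
    intro j hj
    unfold fX
    rw [← Finset.sum_Ico_consecutive _ hj (by omega : m ≤ n), Finset.sum_eq_zero, zero_add,
      div_self hZpos.ne']
    intro s hs
    rw [Finset.mem_Ico] at hs
    rw [Dq, if_pos hs.2]
  have hfn : fX q p1 p2 m n n = 0 := by simp [fX]
  haveI := hprob k
  set G : ℕ → ℕ → ℝ := fun t j => (μ k).real (Eev m n t j) with hG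
  have hG0 : ∀ t j, 0 ≤ G t j := fun t j => measureReal_nonneg
  have hstep : ∀ t j, G (t + 1) j = ∑ i ∈ Finset.Ioo m n, G t i * transX q p1 p2 i j :=
    fun t j => Eev_step (μ k) _ k (hμ k) m n t j
      fun i _ => transX_nonneg q p1 p2 hq hp1 hp2 i j
  have hinit : ∀ j, G 0 j = if j = k then 1 else 0 := by
    intro j
    have e : Eev m n 0 j = {ω | ω 0 = j} := by ext ω; simp [Eev]
    have h1 := (hμ k).1
    simp only [hG]
    split_ifs with hj
    · rw [e, hj, measureReal_def, h1]; rfl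
    · have hms : MeasurableSet {ω : ℕ → ℕ | ω 0 = k} :=
        measurableSet_eq_fun (measurable_pi_apply 0) measurable_const
      have h2 : (μ k) {ω : ℕ → ℕ | ω 0 = k}ᶜ = 0 := (prob_compl_eq_zero_iff hms).mpr h1
      have h3 : (μ k) (Eev m n 0 j) = 0 := by
        refine measure_mono_null ?_ h2
        rw [e]
        intro ω hω h'
        exact hj (hω.symm.trans h')
      rw [measureReal_def, h3]; rfl
  -- summability of disjoint events
  have hsumm : ∀ S : ℕ → Set (ℕ → ℕ), (∀ t, MeasurableSet (S t)) →
      Pairwise (Function.onFun Disjoint S) →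
      HasSum (fun t => (μ k).real (S t)) ((μ k) (⋃ t, S t)).toReal := by
    intro S h1 h2
    rw [measure_iUnion h2 h1, ENNReal.tsum_toReal_eq (fun t => measure_ne_top _ _)]
    refine (ENNReal.summable_toReal ?_).hasSum
    rw [← measure_iUnion h2 h1]
    exact measure_ne_top _ _
  have hdisj : ∀ (A : Set ℕ), (∀ a ∈ A, ¬ (m < a ∧ a < n)) → ∀ t t' (ω : ℕ → ℕ), ω t ∈ A →
      ω t' ∈ A → (∀ i < t, m < ω i ∧ ω i < n) → (∀ i < t', m < ω i ∧ ω i < n) → t = t' := by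
    intro A hA t t' ω h1 h2 h3 h4
    rcases lt_trichotomy t t' with h | h | h
    · exact absurd (h4 t h) (hA _ h1)
    · exact h
    · exact absurd (h3 t' h) (hA _ h2)
  have hGn : Tendsto (fun t => G t n) atTop (𝓝 0) := by
    refine (hsumm (fun t => Eev m n t n) (fun t => meas_Eev _ _ _ _) ?_).summable.tendsto_atTop_zero
    intro t t' htt
    refine Set.disjoint_left.mpr fun ω h1 h2 => htt ?_
    exact hdisj {n} (by simp) t t' ω h1.1 h2.1 h1.2 h2.2
  have hGlim : ∀ d i, i + d = n → m < i → Tendsto (fun t => G t i) atTop (𝓝 0) := by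
    intro d
    induction d with
    | zero => intro i hi _; rw [show i = n by omega]; exact hGn
    | succ d ih =>
      intro i hi hmi
      have h1 := ih (i + 1) (by omega) (by omega)
      have hqi := hq i (by omega)
      have h2 : Tendsto (fun t => G (t + 1) (i + 1) / q i) atTop (𝓝 0) := by
        have := ((tendsto_add_atTop_iff_nat 1).mpr h1).div_const (q i)
        simpa using this
      refine squeeze_zero (fun t => hG0 t i) (fun t => ?_) h2
      rw [le_div_iff₀ hqi, hstep]
      have h3 : transX q p1 p2 i (i + 1) = q i := by
        unfold transX
        rw [if_neg (by omega), if_neg (by omega), if_pos rfl]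
      rw [← h3]
      exact Finset.single_le_sum (f := fun i' => G t i' * transX q p1 p2 i' (i + 1))
        (fun i' _ => mul_nonneg (hG0 t i') (transX_nonneg q p1 p2 hq hp1 hp2 _ _))
        (Finset.mem_Ioo.mpr ⟨hmi, by omega⟩)
  set M : ℕ → ℝ := fun t => ∑ i ∈ Finset.Ioo m n, G t i * fX q p1 p2 m n i with hM
  set H : ℕ → ℝ := fun t => ∑ j ∈ Finset.range (m + 1), G t j with hH
  have hMlim : Tendsto M atTop (𝓝 0) := by
    have : Tendsto M atTop (𝓝 (∑ i ∈ Finset.Ioo m n, 0 * fX q p1 p2 m n i)) := by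
      refine tendsto_finsetSum _ fun i hi => ?_
      rw [Finset.mem_Ioo] at hi
      exact (hGlim (n - i) i (by omega) hi.1).mul_const _
    simpa using this
  have hMstep : ∀ t, M t = H (t + 1) + M (t + 1) := by
    intro t
    have e1 : M t = ∑ j ∈ Finset.range (n + 1), G (t + 1) j * fX q p1 p2 m n j := by
      simp only [hM, hstep, Finset.sum_mul]
      rw [Finset.sum_comm]
      refine Finset.sum_congr rfl fun i hi => ?_
      rw [← fX_harm q p1 p2 hq hsum m n hm i hi, Finset.mul_sum]
      exact Finset.sum_congr rfl fun j _ => by ring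
    rw [e1, Finset.sum_range_succ, hfn, mul_zero, add_zero,
      ← Finset.sum_range_add_sum_Ico _ (show m + 1 ≤ n by omega)]
    congr 1
    refine Finset.sum_congr rfl fun j hj => ?_
    rw [Finset.mem_range] at hj
    rw [hf1 j (by omega), mul_one]
  have hM0 : M 0 = fX q p1 p2 m n k := by
    simp only [hM, hinit, ite_mul, one_mul, zero_mul, Finset.sum_ite_eq', Finset.mem_Ioo]
    rw [if_pos ⟨hmk, hkn⟩]
  have hH0 : H 0 = 0 := by
    simp only [hH, hinit]
    refine Finset.sum_eq_zero fun j hj => ?_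
    rw [Finset.mem_range] at hj
    rw [if_neg (by omega)]
  have hpart : ∀ T, ∑ t ∈ Finset.range (T + 1), H t = fX q p1 p2 m n k - M T := by
    intro T
    induction T with
    | zero => simp [hH0, hM0]
    | succ T ih =>
      rw [Finset.sum_range_succ, ih, hMstep T]; ring
  have hlim1 : Tendsto (fun T => ∑ t ∈ Finset.range (T + 1), H t) atTop
      (𝓝 (fX q p1 p2 m n k)) := by
    simp only [hpart]
    simpa using hMlim.const_sub (fX q p1 p2 m n k)
  -- the event
  set S : ℕ → Set (ℕ → ℕ) := fun t => ⋃ j ∈ Finset.range (m + 1), Eev m n t j with hS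
  have hSmem : ∀ t ω, ω ∈ S t ↔ ω t ≤ m ∧ ∀ i < t, m < ω i ∧ ω i < n := by
    intro t ω
    simp only [hS, Eev, Set.mem_iUnion, Finset.mem_range, Set.mem_ofPred_eq, exists_prop]
    constructor
    · rintro ⟨j, hj, h1, h2⟩
      exact ⟨by omega, h2⟩
    · rintro ⟨h1, h2⟩
      exact ⟨ω t, by omega, rfl, h2⟩
  have hSmeas : ∀ t, MeasurableSet (S t) := fun t =>
    Finset.measurableSet_biUnion _ fun j _ => meas_Eev _ _ _ _
  have hSH : ∀ t, (μ k).real (S t) = H t := by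
    intro t
    refine measureReal_biUnion_finset ?_ fun j _ => meas_Eev _ _ _ _
    intro a _ b _ hab
    exact Set.disjoint_left.mpr fun ω h1 h2 => hab (h1.1.symm.trans h2.1)
  have hSd : Pairwise (Function.onFun Disjoint S) := by
    intro t t' htt
    refine Set.disjoint_left.mpr fun ω h1 h2 => htt ?_
    rw [hSmem] at h1 h2
    exact hdisj (Set.Iic m) (fun a ha h => absurd h.1 (not_lt.mpr ha)) t t' ω h1.1 h2.1 h1.2 h2.2
  have hsum2 := hsumm S hSmeas hSd
  simp only [hSH] at hsum2
  have hev : {ω : ℕ → ℕ | ∃ t, ω t ≤ m ∧ ∀ i < t, m < ω i ∧ ω i < n} = ⋃ t, S t := by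
    ext ω
    simp only [Set.mem_iUnion, hSmem, Set.mem_ofPred_eq]
  rw [hev]
  exact tendsto_nhds_unique ((tendsto_add_atTop_iff_nat 1).mpr hsum2.tendsto_sum_nat) hlim1

end
end
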